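/- arXiv:1005.1140 — 3 statements merged into one kernel-verified Lean document; each statement's English description precedes it below -/
import Mathlib

section
/- Let P be a polyline in general position with piecewise-linear parameterization p on [a,b], having a self-intersection p(t₁) = p(t₂) with t₁ < t₂. If the subpolyline of P between p(t₁) and p(t₂) has rotation > −π, then the polyline obtained from P by the loop removal at this self-intersection has rotation at most rot P (the rotation cannot increase). -/
open Real Set Pointwise

noncomputable section

/-- The signed angle from `v` to `w`, in `(-π, π]`; for nonzero non-opposite
vectors it lies in `(-π, π)` and its sign is the sign of the skew product. -/
def vangle (v w : ℝ × ℝ) : ℝ :=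
  Complex.arg ((w.1 + w.2 * Complex.I) / (v.1 + v.2 * Complex.I))

/-- `w` is opposite to `v` : `w = a • v` with `a < 0`. -/
def Opp (v w : ℝ × ℝ) : Prop := ∃ a : ℝ, a < 0 ∧ w = a • v

/-- A shift sequence is non-reverse if no two consecutive shifts are opposite. -/
def NonReverse (s : List (ℝ × ℝ)) : Prop := List.Chain' (fun v w => ¬ Opp v w) s

/-- The rotation of a polyline with the given shift sequence:
the sum of the signed angles between consecutive shifts. -/
def rotShifts : List (ℝ × ℝ) → ℝ
  | v :: w :: rest => vangle v w + rotShifts (w :: rest)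
  | _ => 0

/-- The angular convexity of a polyline with shift sequence `s` :
the minimum of the rotations of its contiguous subpolylines. -/
def acoShifts (s : List (ℝ × ℝ)) : ℝ :=
  sInf (rotShifts '' { t : List (ℝ × ℝ) | t <:+: s })

/-- The (cyclic) rotation of a closed polyline with shift sequence `s`. -/
def rotClosed (s : List (ℝ × ℝ)) : ℝ := rotShifts (s ++ s.take 1)

/-- The angular convexity of a closed polyline with shift sequence `s` :
the minimum of the rotations over all (possibly wrapping) contiguous
subpolylines traversing the cycle at most once, oriented along it. -/
def acoClosed (s : List (ℝ × ℝ)) : ℝ :=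
  sInf (rotShifts '' { t : List (ℝ × ℝ) | t.length ≤ s.length ∧ t <:+: (s ++ s) })

/-- A polyline, given by its first vertex and its shift sequence. -/
structure Polyline where
  start : ℝ × ℝ
  shifts : List (ℝ × ℝ)

namespace Polyline

/-- A genuine polyline: at least one edge and consecutive vertices distinct. -/
def Proper (P : Polyline) : Prop := P.shifts ≠ [] ∧ ∀ v ∈ P.shifts, v ≠ 0

/-- The `i`-th vertex (`0`-indexed). -/
def vert (P : Polyline) (i : ℕ) : ℝ × ℝ := P.start + (P.shifts.take i).sum

/-- The natural piecewise-linear parameterization of `P` on `[0, number of edges]`. -/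
def param (P : Polyline) (t : ℝ) : ℝ × ℝ :=
  P.vert ⌊t⌋.toNat + Int.fract t • P.shifts.getD ⌊t⌋.toNat 0

/-- The polyline as a subset of the plane. -/
def trace (P : Polyline) : Set (ℝ × ℝ) := P.param '' Set.Icc 0 (P.shifts.length : ℝ)

/-- A closed polyline: the last vertex equals the first one. -/
def Closed (P : Polyline) : Prop := P.shifts.sum = 0

/-- A simple (open) polyline: edges may intersect only at a common vertex of
consecutive edges, i.e. the natural parameterization is injective. -/
def Simple (P : Polyline) : Prop := Set.InjOn P.param (Set.Icc 0 (P.shifts.length : ℝ))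

/-- A simple closed polyline: closed and injective except for first = last point. -/
def SimpleClosed (P : Polyline) : Prop :=
  P.Closed ∧ Set.InjOn P.param (Set.Ico 0 (P.shifts.length : ℝ))

/-- The `i`-th edge as a segment in the plane. -/
def edge (P : Polyline) (i : ℕ) : Set (ℝ × ℝ) := segment ℝ (P.vert i) (P.vert (i + 1))

/-- A polyline is in general position if all vertices are distinct, two edges meet
in at most one point which is either the common vertex of consecutive edges or lies
in the relative interiors of both, and no three edges have a common point. -/
def GeneralPosition (P : Polyline) : Prop :=
  (∀ i j, i < j → j ≤ P.shifts.length → P.vert i ≠ P.vert j) ∧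
  (∀ i j, i < j → j < P.shifts.length →
    (P.edge i ∩ P.edge j).Subsingleton ∧
    ∀ x ∈ P.edge i ∩ P.edge j,
      (j = i + 1 ∧ x = P.vert j) ∨
      (x ∈ openSegment ℝ (P.vert i) (P.vert (i + 1)) ∧
        x ∈ openSegment ℝ (P.vert j) (P.vert (j + 1)))) ∧
  ∀ i j k, i < j → j < k → k < P.shifts.length →
    P.edge i ∩ P.edge j ∩ P.edge k = ∅

end Polyline

/-- `P` is the (anticlockwise-oriented) closed simple boundary polyline of the
simple polygon `K`. -/
structure IsSimplePolygon (K : Set (ℝ × ℝ)) (P : Polyline) : Prop where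
  compact : IsCompact K
  regular : K = closure (interior K)
  proper : P.Proper
  nonReverse : NonReverse (P.shifts ++ P.shifts.take 1)
  simpleClosed : P.SimpleClosed
  boundary : frontier K = P.trace
  orient : rotClosed P.shifts = 2 * π

/-- The ray with apex `x` and direction `d`. -/
def ray (x d : ℝ × ℝ) : Set (ℝ × ℝ) := {y | ∃ t : ℝ, 0 ≤ t ∧ y = x + t • d}

/-- The angular region with apex `x` spanned by the directions `u` and `v` :
the convex hull of the two rays. Its angular measure is `|vangle u v|`. -/
def angularRegion (x u v : ℝ × ℝ) : Set (ℝ × ℝ) :=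
  convexHull ℝ (ray x u ∪ ray x v)

/-- The merge of two shift sequences used in the sorted sum: repeatedly take the
head of the remaining sequence with the larger rotation (preferring the first). -/
def sortedMerge : List (ℝ × ℝ) → List (ℝ × ℝ) → List (ℝ × ℝ)
  | [], t => t
  | s, [] => s
  | a :: s, b :: t =>
    if rotShifts (b :: t) ≤ rotShifts (a :: s) then a :: sortedMerge s (b :: t)
    else b :: sortedMerge (a :: s) t
termination_by s t => s.length + t.length

/-- The hypotheses of the sorted sum: both polylines are proper and non-reverse,
their first shifts have the same direction, and their rotations are equal. -/
def SortedSumHyp (P Q : Polyline) : Prop :=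
  P.Proper ∧ Q.Proper ∧ NonReverse P.shifts ∧ NonReverse Q.shifts ∧
  vangle P.shifts.headI Q.shifts.headI = 0 ∧
  rotShifts P.shifts = rotShifts Q.shifts

/-- The sorted sum `P +ₛ Q` : starts at the sum of the first vertices and has the
merged shift sequence. -/
def sortedSum (P Q : Polyline) : Polyline :=
  ⟨P.start + Q.start, sortedMerge P.shifts Q.shifts⟩

/-- The shift sequence of the polyline obtained from `P` by the loop removal at
a self-intersection `P.param t₁ = P.param t₂` (`t₁ < t₂`): the part of `P`
before `t₁` (including the partial edge ending at `P.param t₁` when `t₁` is not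
a vertex) concatenated with the part of `P` after `t₂`. -/
def removeLoop (P : Polyline) (t₁ t₂ : ℝ) : Polyline where
  start := P.start
  shifts :=
    P.shifts.take ⌊t₁⌋.toNat ++
    (if Int.fract t₁ = 0 then [] else [P.param t₁ - P.vert ⌊t₁⌋.toNat]) ++
    (if Int.fract t₂ = 0 then [] else [P.vert (⌊t₂⌋.toNat + 1) - P.param t₂]) ++
    P.shifts.drop (⌊t₂⌋.toNat + if Int.fract t₂ = 0 then 0 else 1)

/-- The shift sequence of the subpolyline (loop) of `P` between `P.param t₁`
and `P.param t₂`. -/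
def loopShifts (P : Polyline) (t₁ t₂ : ℝ) : List (ℝ × ℝ) :=
  (if Int.fract t₁ = 0 then [] else [P.vert (⌊t₁⌋.toNat + 1) - P.param t₁]) ++
  ((P.shifts.drop (⌊t₁⌋.toNat + if Int.fract t₁ = 0 then 0 else 1)).take
    (⌊t₂⌋.toNat - (⌊t₁⌋.toNat + if Int.fract t₁ = 0 then 0 else 1))) ++
  (if Int.fract t₂ = 0 then [] else [P.param t₂ - P.vert ⌊t₂⌋.toNat])

lemma cnz (v : ℝ × ℝ) (hv : v ≠ 0) : ((v.1 : ℂ) + v.2 * Complex.I) ≠ 0 := by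
  intro h
  apply hv
  have h1 := congrArg Complex.re h
  have h2 := congrArg Complex.im h
  simp at h1 h2
  exact Prod.ext h1 h2

lemma csmul (a : ℝ) (v : ℝ × ℝ) :
    (((a • v).1 : ℂ) + ((a • v).2 : ℂ) * Complex.I) = (a : ℂ) * (v.1 + v.2 * Complex.I) := by
  simp
  ring

lemma vangle_smul_left (a : ℝ) (ha : 0 < a) (v w : ℝ × ℝ) :
    vangle (a • v) w = vangle v w := by
  unfold vangle
  have h : ∀ z y : ℂ, z / ((a : ℂ) * y) = ((a⁻¹ : ℝ) : ℂ) * (z / y) := by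
    intro z y
    rw [Complex.ofReal_inv, div_eq_mul_inv, div_eq_mul_inv, mul_inv]
    ring
  rw [csmul, h]
  exact Complex.arg_real_mul _ (inv_pos.mpr ha)

lemma vangle_smul_right (a : ℝ) (ha : 0 < a) (v w : ℝ × ℝ) :
    vangle v (a • w) = vangle v w := by
  unfold vangle
  rw [csmul, mul_div_assoc]
  exact Complex.arg_real_mul _ ha

lemma rot_split (A : List (ℝ × ℝ)) (u : ℝ × ℝ) (C : List (ℝ × ℝ)) :
    rotShifts (A ++ u :: C) = rotShifts (A ++ [u]) + rotShifts (u :: C) := by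
  induction A with
  | nil => simp [rotShifts]
  | cons a A ih =>
    cases A with
    | nil => simp [rotShifts]
    | cons b A =>
      simp only [List.cons_append, rotShifts] at ih ⊢
      rw [ih]
      ring

lemma rot_smul_last (A : List (ℝ × ℝ)) (u : ℝ × ℝ) (a : ℝ) (ha : 0 < a) :
    rotShifts (A ++ [a • u]) = rotShifts (A ++ [u]) := by
  induction A with
  | nil => simp [rotShifts]
  | cons c A ih =>
    cases A with
    | nil => simp [rotShifts, vangle_smul_right a ha]
    | cons b A =>
      simp only [List.cons_append, rotShifts] at ih ⊢
      rw [ih]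

lemma rot_smul_head (B : List (ℝ × ℝ)) (u : ℝ × ℝ) (a : ℝ) (ha : 0 < a) :
    rotShifts ((a • u) :: B) = rotShifts (u :: B) := by
  cases B with
  | nil => simp [rotShifts]
  | cons b B => simp [rotShifts, vangle_smul_left a ha]

lemma vangle_coe (v w : ℝ × ℝ) (hv : v ≠ 0) (hw : w ≠ 0) :
    ((vangle v w : ℝ) : Real.Angle) =
      (Complex.arg (w.1 + w.2 * Complex.I) : Real.Angle)
        - (Complex.arg (v.1 + v.2 * Complex.I) : Real.Angle) :=
  Complex.arg_div_coe_angle (cnz w hw) (cnz v hv)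

lemma rot_coe (M : List (ℝ × ℝ)) (u w : ℝ × ℝ) (hu : u ≠ 0) (hw : w ≠ 0)
    (hM : ∀ v ∈ M, v ≠ 0) :
    ((rotShifts (u :: (M ++ [w])) : ℝ) : Real.Angle) = (vangle u w : Real.Angle) := by
  induction M generalizing u with
  | nil => simp [rotShifts]
  | cons m M ih =>
    have hm : m ≠ 0 := hM m (by simp)
    have := ih m hm (fun v hv => hM v (by simp [hv]))
    simp only [List.cons_append, rotShifts, Real.Angle.coe_add] at this ⊢
    rw [this, vangle_coe _ _ hu hm, vangle_coe _ _ hm hw, vangle_coe _ _ hu hw]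
    abel

lemma vangle_le_rot (M : List (ℝ × ℝ)) (u w : ℝ × ℝ) (hu : u ≠ 0) (hw : w ≠ 0)
    (hM : ∀ v ∈ M, v ≠ 0) (h : -π < rotShifts (u :: (M ++ [w]))) :
    vangle u w ≤ rotShifts (u :: (M ++ [w])) := by
  obtain ⟨k, hk⟩ := Real.Angle.angle_eq_iff_two_pi_dvd_sub.mp (rot_coe M u w hu hw hM)
  have h2 : vangle u w ≤ π := Complex.arg_le_pi _
  have hpi := Real.pi_pos
  have hk0 : 0 ≤ k := by
    by_contra hneg
    have : (k : ℝ) ≤ -1 := by exact_mod_cast (by omega : k ≤ -1)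
    nlinarith
  have : (0 : ℝ) ≤ k := by exact_mod_cast hk0
  nlinarith

lemma vert_succ (P : Polyline) (i : ℕ) (hi : i < P.shifts.length) :
    P.vert (i + 1) = P.vert i + P.shifts[i] := by
  unfold Polyline.vert
  rw [List.sum_take_succ _ _ hi, add_assoc]

lemma list_split (s : List (ℝ × ℝ)) (i j : ℕ) (hij : i < j) (hj : j < s.length) :
    s = s.take i ++ s[i] :: ((s.drop (i + 1)).take (j - (i + 1)) ++ s[j] :: s.drop (j + 1)) := by
  have h1 : s[j] :: s.drop (j + 1) = s.drop j := (List.drop_eq_getElem_cons hj).symm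
  have h2 : (s.drop (i + 1)).take (j - (i + 1)) ++ s.drop j = s.drop (i + 1) := by
    have := List.take_append_drop (j - (i + 1)) (s.drop (i + 1))
    rw [List.drop_drop, show i + 1 + (j - (i + 1)) = j by omega] at this
    exact this
  rw [h1, h2, ← List.drop_eq_getElem_cons (by omega : i < s.length), List.take_append_drop]

/-- An interior parameter of an edge. -/
lemma param_floor (P : Polyline) (t : ℝ) (ht : t ∈ Set.Icc (0 : ℝ) (P.shifts.length : ℝ)) :
    (Int.fract t = 0 ∧ ∃ n : ℕ, n ≤ P.shifts.length ∧ t = n ∧ P.param t = P.vert n) ∨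
    (Int.fract t ≠ 0 ∧ ∃ (n : ℕ) (h : n < P.shifts.length), ⌊t⌋.toNat = n ∧
      0 < Int.fract t ∧ Int.fract t < 1 ∧ t = n + Int.fract t ∧
      P.param t = P.vert n + Int.fract t • P.shifts[n]) := by
  have h0 : (0 : ℤ) ≤ ⌊t⌋ := Int.floor_nonneg.mpr ht.1
  have hc : ((⌊t⌋.toNat : ℕ) : ℝ) = (⌊t⌋ : ℝ) := by
    have := Int.toNat_of_nonneg h0
    exact_mod_cast this
  have hft := Int.floor_add_fract t
  rw [← hc] at hft
  by_cases hf : Int.fract t = 0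
  · left
    refine ⟨hf, ⌊t⌋.toNat, ?_, ?_, ?_⟩
    · have := ht.2
      rw [← hft, hf, add_zero] at this
      exact_mod_cast this
    · linarith
    · simp [Polyline.param, hf]
  · right
    have hpos : 0 < Int.fract t := lt_of_le_of_ne (Int.fract_nonneg t) (Ne.symm hf)
    have hlt : ⌊t⌋.toNat < P.shifts.length := by
      have : ((⌊t⌋.toNat : ℕ) : ℝ) < P.shifts.length := by linarith [ht.2]
      exact_mod_cast this
    refine ⟨hf, ⌊t⌋.toNat, hlt, rfl, hpos, Int.fract_lt_one t, hft.symm, ?_⟩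
    simp [Polyline.param, hlt]

lemma mem_edge (P : Polyline) (n : ℕ) (h : n < P.shifts.length) (f : ℝ) (h0 : 0 ≤ f)
    (h1 : f ≤ 1) : P.vert n + f • P.shifts[n] ∈ P.edge n := by
  refine ⟨1 - f, f, by linarith, h0, by ring, ?_⟩
  rw [vert_succ P n h]
  module

lemma edge_left (P : Polyline) (n : ℕ) : P.vert n ∈ P.edge n := left_mem_segment _ _ _
lemma edge_right (P : Polyline) (n : ℕ) : P.vert (n + 1) ∈ P.edge n := right_mem_segment _ _ _

lemma both_interior (P : Polyline) (hP : P.Proper) (hgen : P.GeneralPosition)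
    (t₁ t₂ : ℝ) (ht₁ : t₁ ∈ Set.Icc (0 : ℝ) (P.shifts.length : ℝ))
    (ht₂ : t₂ ∈ Set.Icc (0 : ℝ) (P.shifts.length : ℝ)) (hlt : t₁ < t₂)
    (hself : P.param t₁ = P.param t₂) :
    Int.fract t₁ ≠ 0 ∧ Int.fract t₂ ≠ 0 ∧ ⌊t₁⌋.toNat < ⌊t₂⌋.toNat := by
  obtain ⟨hv, he, -⟩ := hgen
  have hnz : ∀ (n : ℕ) (h : n < P.shifts.length), P.shifts[n] ≠ 0 :=
    fun n h => hP.2 _ (List.getElem_mem h)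
  rcases param_floor P t₁ ht₁ with ⟨f1, n, hn, e1, p1⟩ | ⟨f1, n, hn, fl1, pos1, lt1, e1, p1⟩ <;>
  rcases param_floor P t₂ ht₂ with ⟨f2, m, hm, e2, p2⟩ | ⟨f2, m, hm, fl2, pos2, lt2, e2, p2⟩
  · exfalso
    have : n < m := by
      rw [e1, e2] at hlt
      exact_mod_cast hlt
    exact hv n m this hm (by rw [← p1, ← p2, hself])
  · exfalso
    have hnm : n ≤ m := by
      have : (n : ℝ) < m + 1 := by linarith
      exact Nat.lt_succ_iff.mp (by exact_mod_cast this)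
    have hx : P.vert n = P.vert m + Int.fract t₂ • P.shifts[m] := by rw [← p1, ← p2, hself]
    rcases hnm.eq_or_lt with rfl | hnm
    · have : Int.fract t₂ • P.shifts[n] = 0 := by simpa using hx
      exact (smul_ne_zero f2 (hnz n hm)) this
    · have hmem : P.vert n ∈ P.edge n ∩ P.edge m :=
        ⟨edge_left P n, hx ▸ mem_edge P m hm _ pos2.le lt2.le⟩
      rcases (he n m hnm hm).2 _ hmem with ⟨-, h⟩ | ⟨h, -⟩
      · exact hv n m hnm hm.le h
      · exact hv n (n + 1) (by omega) (by omega) (left_mem_openSegment_iff.mp h)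
  · exfalso
    have hnm : n + 1 ≤ m := by
      have : (n : ℝ) < m := by linarith
      exact_mod_cast this
    have hx : P.vert n + Int.fract t₁ • P.shifts[n] = P.vert m := by rw [← p1, ← p2, hself]
    rcases hnm.eq_or_lt with rfl | hnm
    · rw [vert_succ P n hn] at hx
      have : (1 - Int.fract t₁) • P.shifts[n] = 0 := by
        have := add_left_cancel hx
        rw [sub_smul, one_smul, this, sub_self]
      exact (smul_ne_zero (by linarith) (hnz n hn)) this
    · obtain ⟨m, rfl⟩ : ∃ k, m = k + 1 := ⟨m - 1, by omega⟩
      have hmem : P.vert (m + 1) ∈ P.edge n ∩ P.edge m :=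
        ⟨hx ▸ mem_edge P n hn _ pos1.le lt1.le, edge_right P m⟩
      rcases (he n m (by omega) (by omega)).2 _ hmem with ⟨-, h⟩ | ⟨-, h⟩
      · exact hv m (m + 1) (by omega) hm h.symm
      · exact hv m (m + 1) (by omega) hm (right_mem_openSegment_iff.mp h)
  · refine ⟨f1, f2, ?_⟩
    rw [fl1, fl2]
    have hnm : n ≤ m := by
      have : (n : ℝ) < m + 1 := by linarith
      exact Nat.lt_succ_iff.mp (by exact_mod_cast this)
    rcases hnm.eq_or_lt with rfl | hnm
    · exfalso
      have hx := hself
      rw [p1, p2] at hx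
      have h := smul_left_injective ℝ (hnz n hn) (add_left_cancel hx)
      linarith
    · exact hnm

/-- **Lemma (loop removal).** Let `P` be a polyline in general position with a
self-intersection `P.param t₁ = P.param t₂`, `t₁ < t₂`. If the subpolyline of
`P` between `P.param t₁` and `P.param t₂` has rotation `> -π`, then the
rotation cannot increase after the loop removal. -/
theorem rot_removeLoop_le (P : Polyline) (hP : P.Proper)
    (hNR : NonReverse P.shifts) (hgen : P.GeneralPosition)
    (t₁ t₂ : ℝ) (ht₁ : t₁ ∈ Set.Icc (0 : ℝ) (P.shifts.length : ℝ))
    (ht₂ : t₂ ∈ Set.Icc (0 : ℝ) (P.shifts.length : ℝ)) (hlt : t₁ < t₂)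
    (hself : P.param t₁ = P.param t₂)
    (hloop : -π < rotShifts (loopShifts P t₁ t₂)) :
    rotShifts (removeLoop P t₁ t₂).shifts ≤ rotShifts P.shifts := by
  obtain ⟨f1, f2, hij⟩ := both_interior P hP hgen t₁ t₂ ht₁ ht₂ hlt hself
  have hnz : ∀ (n : ℕ) (h : n < P.shifts.length), P.shifts[n] ≠ 0 :=
    fun n h => hP.2 _ (List.getElem_mem h)
  rcases param_floor P t₁ ht₁ with ⟨h, -⟩ | ⟨-, i, hi, fl1, pos1, lt1, e1, p1⟩
  · exact absurd h f1
  rcases param_floor P t₂ ht₂ with ⟨h, -⟩ | ⟨-, j, hj, fl2, pos2, lt2, e2, p2⟩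
  · exact absurd h f2
  have hA : P.param t₁ - P.vert i = Int.fract t₁ • P.shifts[i] := by rw [p1]; module
  have hA' : P.vert (i + 1) - P.param t₁ = (1 - Int.fract t₁) • P.shifts[i] := by
    rw [p1, vert_succ P i hi]; module
  have hB : P.param t₂ - P.vert j = Int.fract t₂ • P.shifts[j] := by rw [p2]; module
  have hB' : P.vert (j + 1) - P.param t₂ = (1 - Int.fract t₂) • P.shifts[j] := by
    rw [p2, vert_succ P j hj]; module
  rw [fl1, fl2] at hij
  simp only [loopShifts, removeLoop, fl1, fl2, f1, f2, if_false, hA, hA', hB, hB'] at hloop ⊢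
  conv_rhs => rw [list_split P.shifts i j hij hj]
  have hM : ∀ v ∈ (P.shifts.drop (i + 1)).take (j - (i + 1)), v ≠ 0 :=
    fun v hv => hP.2 v (List.mem_of_mem_drop (List.mem_of_mem_take hv))
  generalize (P.shifts.drop (i + 1)).take (j - (i + 1)) = M at *
  have hui := hnz i hi
  have hwj := hnz j hj
  generalize P.shifts[i] = u at *
  generalize P.shifts[j] = w at *
  generalize P.shifts.take i = A at *
  generalize P.shifts.drop (j + 1) = B at *
  have q1 : 0 < 1 - Int.fract t₁ := by linarith
  have q2 : 0 < 1 - Int.fract t₂ := by linarith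
  rw [rot_smul_last _ _ _ pos2] at hloop
  simp only [List.append_assoc, List.cons_append, List.nil_append] at hloop ⊢
  rw [rot_smul_head _ _ _ q1] at hloop
  have key := vangle_le_rot M u w hui hwj hM hloop
  have r1 : rotShifts (u :: (M ++ w :: B)) = rotShifts (u :: (M ++ [w])) + rotShifts (w :: B) :=
    rot_split (u :: M) w B
  rw [rot_split A u, r1, rot_split A (_ • u), rot_smul_last _ _ _ pos1, rot_smul_head _ _ _ pos1]
  simp only [rotShifts]
  rw [vangle_smul_right _ q2, rot_smul_head _ _ _ q2]
  linarith
end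
end

section
/- Let K be a simple polygon with aco K > −π, with boundary ∂K oriented so that rot ∂K = 2π. Then every simple subpolyline L of ∂K (oriented along ∂K) satisfies rot L < 3π. -/
open Real Set Pointwise

noncomputable section

/-- The cyclic `i`-th shift. -/
def cyc (s : List (ℝ × ℝ)) (i : ℕ) : ℝ × ℝ := s.getD (i % s.length) 0

/-- The cyclic window of length `m` starting at `k`. -/
def win (s : List (ℝ × ℝ)) (k m : ℕ) : List (ℝ × ℝ) :=
  (List.range m).map (fun j => cyc s (k + j))

/-- The cyclic turning angle at index `k`. -/
def turn (s : List (ℝ × ℝ)) (k : ℕ) : ℝ := vangle (cyc s k) (cyc s (k + 1))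

theorem win_succ (s : List (ℝ × ℝ)) (k m : ℕ) :
    win s k (m + 1) = cyc s k :: win s (k + 1) m := by
  unfold win
  rw [List.range_succ_eq_map]
  simp only [List.map_cons, List.map_map, Nat.add_zero]
  congr 1
  apply List.map_congr_left
  intro a _
  simp only [Function.comp, Nat.succ_eq_add_one]
  congr 1
  omega

theorem rot_win (s : List (ℝ × ℝ)) (m : ℕ) : ∀ k,
    rotShifts (win s k (m + 1)) = ∑ j ∈ Finset.Ico k (k + m), turn s j := by
  induction m with
  | zero => intro k; simp [win, rotShifts]
  | succ m ih =>
    intro k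
    rw [win_succ, win_succ, rotShifts, ← win_succ, ih,
      Finset.sum_eq_sum_Ico_succ_bot (by omega : k < k + (m + 1))]
    rw [show k + 1 + m = k + (m + 1) by omega]
    rfl

theorem win_mod (s : List (ℝ × ℝ)) (k m : ℕ) : win s (k % s.length) m = win s k m := by
  unfold win cyc
  simp

theorem getElem_dbl (s : List (ℝ × ℝ)) (i : ℕ) (h : i < (s ++ s).length) :
    (s ++ s)[i] = cyc s i := by
  have h' : i < s.length + s.length := by simpa using h
  unfold cyc
  by_cases hi : i < s.length
  · rw [List.getElem_append_left hi, Nat.mod_eq_of_lt hi, List.getD_eq_getElem _ _ hi]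
  · have hm : i % s.length = i - s.length := by
      rw [Nat.mod_eq_sub_mod (by omega), Nat.mod_eq_of_lt (by omega)]
    rw [List.getElem_append_right (by omega), hm, List.getD_eq_getElem _ _ (by omega)]

theorem take_drop_dbl (s : List (ℝ × ℝ)) (k m : ℕ) (h : k + m ≤ s.length + s.length) :
    ((s ++ s).drop k).take m = win s k m := by
  apply List.ext_getElem
  · simp [win]; omega
  · intro i h1 h2
    rw [List.getElem_take, List.getElem_drop, getElem_dbl]
    simp [win]

theorem win_infix (s : List (ℝ × ℝ)) (k m : ℕ) (hs : 0 < s.length) (hm : m ≤ s.length) :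
    win s k m <:+: s ++ s := by
  have hk := Nat.mod_lt k hs
  rw [← win_mod, ← take_drop_dbl _ _ _ (by omega)]
  exact (List.take_prefix _ _).isInfix.trans (List.drop_suffix _ _).isInfix

theorem infix_win (s t : List (ℝ × ℝ)) (h : t <:+: s ++ s) : ∃ k, t = win s k t.length := by
  obtain ⟨a, b, hab⟩ := h
  refine ⟨a.length, ?_⟩
  have hl := congrArg List.length hab
  simp only [List.length_append] at hl
  rw [← take_drop_dbl _ _ _ (by omega), ← hab]
  simp

theorem rotClosed_eq (s : List (ℝ × ℝ)) (hs : 0 < s.length) :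
    rotClosed s = ∑ j ∈ Finset.Ico 0 s.length, turn s j := by
  have h := rot_win s s.length 0
  rw [Nat.zero_add] at h
  rw [← h, ← take_drop_dbl _ _ _ (by omega), rotClosed, List.drop_zero, List.take_append,
    List.take_of_length_le (by omega : s.length ≤ s.length + 1)]
  simp

theorem turn_periodic (s : List (ℝ × ℝ)) : Function.Periodic (turn s) s.length := by
  intro k
  unfold turn cyc
  rw [show k + s.length + 1 = k + 1 + s.length by omega]
  simp

theorem sum_turn (s : List (ℝ × ℝ)) (k : ℕ) :
    ∑ j ∈ Finset.Ico k (k + s.length), turn s j = ∑ j ∈ Finset.Ico 0 s.length, turn s j := by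
  induction k with
  | zero => simp
  | succ k ih =>
    rw [← ih]
    by_cases hs : s.length = 0
    · simp [hs]
    · rw [Finset.sum_eq_sum_Ico_succ_bot (by omega : k < k + s.length),
        show k + 1 + s.length = (k + s.length) + 1 by omega,
        Finset.sum_Ico_succ_top (by omega), turn_periodic s k]
      ring

theorem aco_le (s t : List (ℝ × ℝ)) (h : t <:+: s ++ s) (hl : t.length ≤ s.length) :
    acoClosed s ≤ rotShifts t := by
  apply csInf_le
  · apply Set.Finite.bddBelow
    apply Set.Finite.image
    apply Set.Finite.subset (List.finite_toSet (s ++ s).sublists)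
    intro u hu
    simpa using hu.2.sublist
  · exact ⟨t, ⟨hl, h⟩, rfl⟩

/-- If `K` is a simple polygon with `aco K > -π`, then every simple
subpolyline of `∂K`, oriented along `∂K`, has rotation `< 3π`. -/
theorem rot_subpolyline_lt_three_pi (K : Set (ℝ × ℝ)) (P : Polyline)
    (hK : IsSimplePolygon K P) (haco : -π < acoClosed P.shifts) :
    ∀ t : List (ℝ × ℝ), t <:+: (P.shifts ++ P.shifts) →
      t.length ≤ P.shifts.length → rotShifts t < 3 * π := by
  intro t ht hl
  obtain ⟨k, hk⟩ := infix_win _ _ ht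
  have hpi := Real.pi_pos
  set s := P.shifts with hs
  by_cases hm : t.length ≤ 1
  · have h0 : rotShifts t = 0 := by
      rcases t with _ | ⟨a, _ | ⟨b, t⟩⟩
      · rfl
      · rfl
      · simp at hm
    rw [h0]; linarith
  · obtain ⟨m, hmt⟩ : ∃ m, t.length = m + 2 := ⟨t.length - 2, by omega⟩
    have hn : 0 < s.length := by omega
    obtain ⟨r, hr⟩ : ∃ r, s.length = m + 2 + r := ⟨s.length - (m + 2), by omega⟩
    have h1 : rotShifts t = ∑ j ∈ Finset.Ico k (k + (m + 1)), turn s j := by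
      rw [hk, hmt]; exact rot_win s (m + 1) k
    have h2 := rot_win s (r + 1) (k + (m + 1))
    have h3 := aco_le s _ (win_infix s (k + (m + 1)) (r + 1 + 1) hn (by omega))
      (by simp [win]; omega)
    have h4 := Finset.sum_Ico_consecutive (turn s) (show k ≤ k + (m + 1) by omega)
      (show k + (m + 1) ≤ k + (m + 1) + (r + 1) by omega)
    have h5 := sum_turn s k
    rw [← rotClosed_eq s hn, hK.orient, hr] at h5
    rw [show k + (m + 1) + (r + 1) = k + (m + 2 + r) by omega] at h4 h2
    linarith
end
end

section
/- For every simple polygon K in the plane, aco K ≤ 0, and aco K = 0 if and only if K is convex. -/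
open Real Set Pointwise

noncomputable section

/-! ### Auxiliary material for the proof -/

/-- Skew product. -/
def crs (v w : ℝ × ℝ) : ℝ := v.1 * w.2 - v.2 * w.1

/-- Complex number of a plane vector. -/
def toC (v : ℝ × ℝ) : ℂ := v.1 + v.2 * Complex.I

lemma toC_re (v : ℝ × ℝ) : (toC v).re = v.1 := by simp [toC]
lemma toC_im (v : ℝ × ℝ) : (toC v).im = v.2 := by simp [toC]

lemma toC_ne {v : ℝ × ℝ} (h : v ≠ 0) : toC v ≠ 0 := by
  intro h0
  apply h
  have h1 := toC_re v
  have h2 := toC_im v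
  rw [h0] at h1 h2
  exact Prod.ext h1.symm h2.symm

lemma vangle_eq (v w : ℝ × ℝ) : vangle v w = Complex.arg (toC w / toC v) := rfl

lemma div_im (v w : ℝ × ℝ) : (toC w / toC v).im = crs v w / Complex.normSq (toC v) := by
  rw [Complex.div_im, toC_re, toC_im, toC_re, toC_im, crs]; ring

lemma vangle_nonneg_iff {v w : ℝ × ℝ} (hv : v ≠ 0) : 0 ≤ vangle v w ↔ 0 ≤ crs v w := by
  have hp : 0 < Complex.normSq (toC v) := Complex.normSq_pos.2 (toC_ne hv)
  rw [vangle_eq, Complex.arg_nonneg_iff, div_im]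
  constructor
  · intro h
    by_contra hc
    exact absurd h (not_le.2 (div_neg_of_neg_of_pos (not_le.1 hc) hp))
  · intro h; positivity

lemma par_of_crs {v w : ℝ × ℝ} (hv : v ≠ 0) (h : crs v w = 0) : ∃ a : ℝ, w = a • v := by
  unfold crs at h
  by_cases h1 : v.1 = 0
  · have h2 : v.2 ≠ 0 := fun h2 => hv (Prod.ext h1 h2)
    refine ⟨w.2 / v.2, Prod.ext ?_ ?_⟩
    · have : v.2 * w.1 = 0 := by rw [h1] at h; linarith
      simp [h1, (mul_eq_zero.1 this).resolve_left h2]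
    · simp [h2]
  · refine ⟨w.1 / v.1, Prod.ext ?_ ?_⟩
    · simp [h1]
    · simp only [Prod.smul_snd, smul_eq_mul]; field_simp; linarith

lemma vangle_nonpos {v w : ℝ × ℝ} (hv : v ≠ 0) (hw : w ≠ 0) (ho : ¬ Opp v w)
    (h : crs v w ≤ 0) : vangle v w ≤ 0 := by
  rcases h.lt_or_eq with h | h
  · by_contra hc
    have := (vangle_nonneg_iff (w := w) hv).1 (by linarith)
    linarith
  · obtain ⟨a, rfl⟩ := par_of_crs hv h
    have ha : 0 ≤ a := by
      by_contra hc
      exact ho ⟨a, not_le.1 hc, rfl⟩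
    have : toC (a • v) / toC v = (a : ℂ) := by
      have : toC (a • v) = a * toC v := by simp [toC]; ring
      rw [this, mul_div_cancel_right₀ _ (toC_ne hv)]
    rw [vangle_eq, this, Complex.arg_ofReal_of_nonneg ha]

lemma polar {v w : ℝ × ℝ} (hv : v ≠ 0) (hw : w ≠ 0) : ∃ r : ℝ, 0 < r ∧
    toC w = r * Complex.exp (vangle v w * Complex.I) * toC v := by
  refine ⟨‖toC w / toC v‖, norm_pos_iff.2 (div_ne_zero (toC_ne hw) (toC_ne hv)), ?_⟩
  rw [vangle_eq, Complex.norm_mul_exp_arg_mul_I, div_mul_cancel₀ _ (toC_ne hv)]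

lemma crs_polar (v w : ℝ × ℝ) (r φ : ℝ)
    (h : toC w = r * Complex.exp (φ * Complex.I) * toC v) :
    crs v w = r * (v.1 ^ 2 + v.2 ^ 2) * Real.sin φ := by
  have h1 := congrArg Complex.re h
  have h2 := congrArg Complex.im h
  rw [Complex.exp_mul_I, ← Complex.ofReal_cos, ← Complex.ofReal_sin] at h1 h2
  simp only [Complex.mul_re, Complex.mul_im, Complex.add_re, Complex.add_im, Complex.I_re,
    Complex.I_im, Complex.ofReal_re, Complex.ofReal_im, toC_re, toC_im] at h1 h2
  rw [crs, h1, h2]; ring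

lemma crs_add (v a b : ℝ × ℝ) : crs v (a + b) = crs v a + crs v b := by
  simp [crs]; ring
lemma crs_sub (v a b : ℝ × ℝ) : crs v (a - b) = crs v a - crs v b := by
  simp [crs]; ring
lemma crs_smul (v a : ℝ × ℝ) (t : ℝ) : crs v (t • a) = t * crs v a := by
  simp [crs]; ring
lemma crs_zero (v : ℝ × ℝ) : crs v 0 = 0 := by simp [crs]
lemma crs_self (v : ℝ × ℝ) : crs v v = 0 := by simp [crs]; ring
lemma crs_sum (v : ℝ × ℝ) (s : ℕ → ℝ × ℝ) (m : ℕ) :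
    crs v (∑ j ∈ Finset.range m, s j) = ∑ j ∈ Finset.range m, crs v (s j) := by
  induction m with
  | zero => simp [crs_zero]
  | succ m ih => rw [Finset.sum_range_succ, Finset.sum_range_succ, crs_add, ih]

lemma sum_shift {M : Type*} [AddCommMonoid M] (f : ℕ → M) (n : ℕ) (hf : ∀ k, f (k + n) = f k)
    (i : ℕ) : ∑ k ∈ Finset.range n, f (i + k) = ∑ k ∈ Finset.range n, f k := by
  induction i with
  | zero => simp
  | succ i ih =>
    rw [← ih]
    have h1 := Finset.sum_range_succ (fun k => f (i + k)) n
    have h2 := Finset.sum_range_succ' (fun k => f (i + k)) n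
    rw [h1] at h2
    cases n with
    | zero => simp
    | succ n =>
      rw [Finset.sum_range_succ, Finset.sum_range_succ' (fun k => f (i + k))]
      congr 1
      · apply Finset.sum_congr rfl
        intro k _
        congr 1; ring
      · rw [← hf (i + 0)]; congr 1; ring

lemma core (s : ℕ → ℝ × ℝ) (n : ℕ) (hs : ∀ k, s k ≠ 0)
    (hθ : ∀ k, 0 ≤ vangle (s k) (s (k + 1)))
    (hsum : ∑ k ∈ Finset.range n, vangle (s k) (s (k + 1)) = 2 * π)
    (h0 : ∑ k ∈ Finset.range n, s k = 0) (m : ℕ) (hm : m ≤ n) :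
    0 ≤ crs (s 0) (∑ j ∈ Finset.range m, s j) := by
  set φ : ℕ → ℝ := fun j => ∑ k ∈ Finset.range j, vangle (s k) (s (k + 1)) with hφ
  have hmono : Monotone φ := by
    apply monotone_nat_of_le_succ
    intro k
    simp only [hφ, Finset.sum_range_succ]
    linarith [hθ k]
  have hφ0 : φ 0 = 0 := by simp [hφ]
  have hφn : φ n = 2 * π := hsum
  have hpol : ∀ j, ∃ r : ℝ, 0 < r ∧
      toC (s j) = r * Complex.exp (φ j * Complex.I) * toC (s 0) := by
    intro j
    induction j with
    | zero => exact ⟨1, one_pos, by simp [hφ0]⟩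
    | succ j ih =>
      obtain ⟨r, hr, h⟩ := ih
      obtain ⟨r', hr', h'⟩ := polar (hs j) (hs (j + 1))
      refine ⟨r * r', mul_pos hr hr', ?_⟩
      have : φ (j + 1) = φ j + vangle (s j) (s (j + 1)) := by
        simp only [hφ, Finset.sum_range_succ]
      rw [h', h, this]
      push_cast
      rw [add_mul, Complex.exp_add]
      ring
  have hc : ∀ j, ∃ A : ℝ, 0 ≤ A ∧ crs (s 0) (s j) = A * Real.sin (φ j) := by
    intro j
    obtain ⟨r, hr, h⟩ := hpol j
    exact ⟨_, by positivity, crs_polar _ _ _ _ h⟩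
  rcases le_total (φ m) π with hle | hge
  · rw [crs_sum]
    apply Finset.sum_nonneg
    intro j hj
    obtain ⟨A, hA, h⟩ := hc j
    rw [h]
    have := hmono (Finset.mem_range.1 hj).le
    have h1 := hmono (Nat.zero_le j)
    exact mul_nonneg hA (Real.sin_nonneg_of_nonneg_of_le_pi (by linarith) (by linarith))
  · have htot : crs (s 0) (∑ j ∈ Finset.range n, s j) = 0 := by rw [h0, crs_zero]
    rw [crs_sum] at htot ⊢
    rw [← Finset.sum_range_add_sum_Ico _ hm] at htot
    have : ∑ j ∈ Finset.Ico m n, crs (s 0) (s j) ≤ 0 := by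
      apply Finset.sum_nonpos
      intro j hj
      obtain ⟨hj1, hj2⟩ := Finset.mem_Ico.1 hj
      obtain ⟨A, hA, h⟩ := hc j
      rw [h]
      have h1 := hmono hj1
      have h2 := hmono hj2.le
      apply mul_nonpos_of_nonneg_of_nonpos hA
      have : Real.sin (φ j) = - Real.sin (φ j - π) := by rw [Real.sin_sub_pi]; ring
      rw [this]
      have := Real.sin_nonneg_of_nonneg_of_le_pi (x := φ j - π) (by linarith) (by linarith)
      linarith
    linarith

lemma rotShifts_eq (l : List (ℝ × ℝ)) : rotShifts l =
    ∑ i ∈ Finset.range (l.length - 1), vangle (l.getD i 0) (l.getD (i + 1) 0) := by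
  induction l with
  | nil => simp [rotShifts]
  | cons a l ih =>
    cases l with
    | nil => simp [rotShifts]
    | cons b l =>
      rw [rotShifts, ih]
      simp only [List.length_cons, Nat.add_sub_cancel]
      rw [Finset.sum_range_succ' _ l.length, add_comm]
      simp

/-- The periodic extension of a list. -/
def per (l : List (ℝ × ℝ)) (k : ℕ) : ℝ × ℝ := l.getD (k % l.length) 0

lemma per_add (l : List (ℝ × ℝ)) (k : ℕ) : per l (k + l.length) = per l k := by simp [per]

lemma getD_take1 (l : List (ℝ × ℝ)) (hl : l ≠ []) (i : ℕ) (hi : i ≤ l.length) :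
    (l ++ l.take 1).getD i 0 = per l i := by
  have hp : 0 < l.length := List.length_pos_iff.2 hl
  rcases hi.lt_or_eq with h | h
  · rw [List.getD_append _ _ _ _ h, per, Nat.mod_eq_of_lt h]
  · subst h
    rw [List.getD_append_right _ _ _ _ le_rfl, per, Nat.mod_self]
    cases l with
    | nil => simp
    | cons a l => simp

lemma rotClosed_eq_s10 (l : List (ℝ × ℝ)) (hl : l ≠ []) : rotClosed l =
    ∑ i ∈ Finset.range l.length, vangle (per l i) (per l (i + 1)) := by
  have hp : 0 < l.length := List.length_pos_iff.2 hl
  rw [rotClosed, rotShifts_eq]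
  have : (l ++ l.take 1).length - 1 = l.length := by simp; omega
  rw [this]
  apply Finset.sum_congr rfl
  intro i hi
  have := Finset.mem_range.1 hi
  rw [getD_take1 l hl i (by omega), getD_take1 l hl (i + 1) (by omega)]

lemma getElem_dup (l : List (ℝ × ℝ)) (i : ℕ) (hi : i < (l ++ l).length) :
    (l ++ l)[i] = per l i := by
  have hi' : i < l.length + l.length := by simpa using hi
  rw [← List.getD_eq_getElem (l ++ l) 0 hi, per]
  rcases lt_or_ge i l.length with h | h
  · rw [List.getD_append _ _ _ _ h, Nat.mod_eq_of_lt h]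
  · rw [List.getD_append_right _ _ _ _ h, Nat.mod_eq_sub_mod h, Nat.mod_eq_of_lt (by omega)]

lemma rot_nonneg (t : List (ℝ × ℝ)) (h : List.IsChain (fun v w => 0 ≤ vangle v w) t) :
    0 ≤ rotShifts t := by
  induction t with
  | nil => simp [rotShifts]
  | cons a t ih =>
    cases t with
    | nil => simp [rotShifts]
    | cons b t =>
      rw [List.isChain_cons_cons] at h
      rw [rotShifts]
      linarith [ih h.2, h.1]

lemma aco_bdd (l : List (ℝ × ℝ)) :
    BddBelow (rotShifts '' { t : List (ℝ × ℝ) | t.length ≤ l.length ∧ t <:+: (l ++ l) }) := by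
  apply Set.Finite.bddBelow
  apply Set.Finite.image
  apply Set.Finite.subset (List.finite_toSet (l ++ l).sublists)
  intro t ht
  exact List.mem_sublists.2 ht.2.sublist

lemma aco_nonpos (l : List (ℝ × ℝ)) : acoClosed l ≤ 0 :=
  csInf_le (aco_bdd l) ⟨[], ⟨by simp, ⟨[], l ++ l, by simp⟩⟩, rfl⟩

lemma aco_eq_zero_iff (l : List (ℝ × ℝ)) (hl : 2 ≤ l.length) :
    acoClosed l = 0 ↔ ∀ k, 0 ≤ vangle (per l k) (per l (k + 1)) := by
  constructor
  · intro h
    have key : ∀ k < l.length, 0 ≤ vangle (per l k) (per l (k + 1)) := by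
      intro k hk
      have hm : rotShifts [per l k, per l (k + 1)] ∈ rotShifts ''
          { t : List (ℝ × ℝ) | t.length ≤ l.length ∧ t <:+: (l ++ l) } := by
        refine ⟨_, ⟨by simpa using hl, ?_⟩, rfl⟩
        have h1 : k < (l ++ l).length := by simp; omega
        have h2 : k + 1 < (l ++ l).length := by simp; omega
        rw [← getElem_dup l k h1, ← getElem_dup l (k + 1) h2]
        refine ⟨(l ++ l).take k, (l ++ l).drop (k + 2), ?_⟩
        conv_rhs => rw [← List.take_append_drop k (l ++ l)]
        rw [List.drop_eq_getElem_cons h1, List.drop_eq_getElem_cons h2]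
        simp only [List.append_assoc, List.cons_append, List.nil_append]
      have := csInf_le (aco_bdd l) hm
      rw [← acoClosed, h] at this
      simpa [rotShifts] using this
    intro k
    have hk := key (k % l.length) (Nat.mod_lt _ (by omega))
    have e1 : per l (k % l.length) = per l k := by simp [per]
    have e2 : per l (k % l.length + 1) = per l (k + 1) := by simp [per]
    rwa [e1, e2] at hk
  · intro h
    apply le_antisymm (aco_nonpos l)
    rw [acoClosed]
    refine le_csInf ⟨rotShifts [], ⟨[], ⟨by simp, ⟨[], l ++ l, by simp⟩⟩, rfl⟩⟩ ?_
    rintro _ ⟨t, ⟨-, ht⟩, rfl⟩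
    apply rot_nonneg
    obtain ⟨a, b, hab⟩ := ht
    suffices hch : List.IsChain (fun v w => 0 ≤ vangle v w) (l ++ l) by
      rw [← hab] at hch
      exact hch.left_of_append.right_of_append
    rw [List.isChain_iff_getElem]
    intro i hi
    rw [getElem_dup, getElem_dup]
    exact h i

/-- Vertices, as an infinite sequence. -/
def ver (P : Polyline) (k : ℕ) : ℝ × ℝ := P.start + ∑ j ∈ Finset.range k, per P.shifts j

lemma ver_succ (P : Polyline) (k : ℕ) : ver P (k + 1) = ver P k + per P.shifts k := by
  rw [ver, ver, Finset.sum_range_succ, add_assoc]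

lemma vert_eq (P : Polyline) (k : ℕ) (hk : k ≤ P.shifts.length) : P.vert k = ver P k := by
  induction k with
  | zero => simp [Polyline.vert, ver]
  | succ k ih =>
    rw [ver_succ, ← ih (by omega), Polyline.vert, Polyline.vert, per,
      Nat.mod_eq_of_lt (by omega), List.sum_take_succ _ _ (by omega), add_assoc,
      List.getD_eq_getElem _ _ (by omega)]

lemma sum_per (P : Polyline) (h : P.Closed) :
    ∑ j ∈ Finset.range P.shifts.length, per P.shifts j = 0 := by
  have := vert_eq P P.shifts.length le_rfl
  rw [Polyline.vert, ver, List.take_length] at this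
  have h2 := add_left_cancel this
  rw [← h2]; exact h

lemma ver_add (P : Polyline) (h : P.Closed) (k : ℕ) :
    ver P (k + P.shifts.length) = ver P k := by
  induction k with
  | zero => simp [ver, sum_per P h]
  | succ k ih =>
    rw [ver_succ, ← ih, ← per_add P.shifts k, ← ver_succ]; congr 1; ring

lemma mem_trace (P : Polyline) (i : ℕ) (hi : i < P.shifts.length) (u : ℝ) (h0 : 0 ≤ u)
    (h1 : u < 1) : ver P i + u • per P.shifts i ∈ P.trace := by
  refine ⟨i + u, ⟨by positivity, ?_⟩, ?_⟩
  · have : (i : ℝ) + 1 ≤ P.shifts.length := by exact_mod_cast hi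
    linarith
  · have hf : ⌊(i : ℝ) + u⌋ = i := by
      rw [Int.floor_eq_iff]; push_cast; constructor <;> linarith
    have hfr : Int.fract ((i : ℝ) + u) = u := by
      rw [Int.fract, hf]; push_cast; ring
    rw [Polyline.param, hf, hfr, Int.toNat_natCast, vert_eq P i hi.le, per, Nat.mod_eq_of_lt hi]

lemma of_mem_trace (P : Polyline) (hn : P.shifts ≠ []) (hc : P.Closed) (x : ℝ × ℝ)
    (hx : x ∈ P.trace) :
    ∃ i < P.shifts.length, ∃ u : ℝ, 0 ≤ u ∧ u ≤ 1 ∧ x = ver P i + u • per P.shifts i := by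
  have hp : 0 < P.shifts.length := List.length_pos_iff.2 hn
  obtain ⟨t, ⟨ht0, ht1⟩, rfl⟩ := hx
  rcases ht1.lt_or_eq with h | h
  · have hi : ⌊t⌋.toNat < P.shifts.length := by
      have : ⌊t⌋ < P.shifts.length := by rw [Int.floor_lt]; exact_mod_cast h
      omega
    refine ⟨⌊t⌋.toNat, hi, Int.fract t, Int.fract_nonneg _, (Int.fract_lt_one _).le, ?_⟩
    rw [Polyline.param, vert_eq P _ hi.le, per, Nat.mod_eq_of_lt hi]
  · refine ⟨0, hp, 0, le_rfl, zero_le_one, ?_⟩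
    subst h
    have := ver_add P hc 0
    rw [zero_add] at this
    rw [Polyline.param]
    simp [vert_eq, this]

lemma per_ne (l : List (ℝ × ℝ)) (hl : l ≠ []) (h : ∀ v ∈ l, v ≠ 0) (k : ℕ) : per l k ≠ 0 := by
  have hp : 0 < l.length := List.length_pos_iff.2 hl
  rw [per, List.getD_eq_getElem _ _ (Nat.mod_lt _ hp)]
  exact h _ (List.getElem_mem _)

/-- An interior point has points strictly lower in the direction of the functional. -/
lemma exists_lower (K : Set (ℝ × ℝ)) (v x : ℝ × ℝ) (hv : v ≠ 0) (hx : x ∈ interior K) :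
    ∃ y ∈ K, crs v y < crs v x := by
  let w : ℝ × ℝ := (v.2, -v.1)
  have hcont : Continuous (fun t : ℝ => x + t • w) := by fun_prop
  have hmem : ∀ᶠ t : ℝ in nhds 0, x + t • w ∈ K := by
    apply hcont.continuousAt.eventually
    simp only [zero_smul, add_zero]
    exact mem_interior_iff_mem_nhds.1 hx
  obtain ⟨ε, hε, hb⟩ := Metric.eventually_nhds_iff.1 hmem
  have h2 := hb (y := ε / 2) (by rw [Real.dist_eq, sub_zero, abs_of_pos (by linarith)]; linarith)
  refine ⟨_, h2, ?_⟩
  rw [crs_add, crs_smul]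
  have hw : crs v w < 0 := by
    have : 0 < v.1 ^ 2 + v.2 ^ 2 := by
      by_contra hc
      apply hv
      exact Prod.ext (by simp; nlinarith [sq_nonneg v.1, sq_nonneg v.2])
        (by simp; nlinarith [sq_nonneg v.1, sq_nonneg v.2])
    simp only [crs, w]; nlinarith
  nlinarith

lemma interior_pos (K : Set (ℝ × ℝ)) (hK : IsCompact K) (v : ℝ × ℝ) (hv : v ≠ 0) (c : ℝ)
    (hf : ∀ x ∈ frontier K, c ≤ crs v x) (x : ℝ × ℝ) (hx : x ∈ interior K) : c < crs v x := by
  have hcont : Continuous (crs v) := by unfold crs; fun_prop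
  obtain ⟨y, hy, hmin⟩ := hK.exists_isMinOn ⟨x, interior_subset hx⟩ hcont.continuousOn
  have hyf : y ∈ frontier K := by
    rw [hK.isClosed.frontier_eq]
    refine ⟨hy, fun hyi => ?_⟩
    obtain ⟨z, hz, hlt⟩ := exists_lower K v y hv hyi
    exact absurd (hmin hz) (not_le.2 hlt)
  obtain ⟨z, hz, hlt⟩ := exists_lower K v x hv hx
  exact lt_of_le_of_lt ((hf y hyf).trans (hmin hz)) hlt

lemma convex_of_angles (K : Set (ℝ × ℝ)) (P : Polyline) (hK : IsSimplePolygon K P)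
    (h : ∀ k, 0 ≤ vangle (per P.shifts k) (per P.shifts (k + 1))) : Convex ℝ K := by
  have hne := per_ne _ hK.proper.1 hK.proper.2
  have hl := hK.proper.1
  have hcl := hK.simpleClosed.1
  have hp : 0 < P.shifts.length := List.length_pos_iff.2 hl
  have hcore : ∀ i m, m ≤ P.shifts.length →
      0 ≤ crs (per P.shifts i) (∑ j ∈ Finset.range m, per P.shifts (i + j)) := by
    intro i m hm
    refine core (fun j => per P.shifts (i + j)) P.shifts.length (fun k => hne _)
      (fun k => h (i + k)) ?_ ?_ m hm
    · have := hK.orient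
      rw [rotClosed_eq_s10 _ hl] at this
      rw [← this]
      refine sum_shift (fun k => vangle (per P.shifts k) (per P.shifts (k + 1))) _ ?_ i
      intro k
      simp only [add_right_comm k _ 1, per_add]
    · rw [sum_shift _ _ (per_add _)]
      exact sum_per P hcl
  have hver : ∀ i m, ver P (i + m) = ver P i + ∑ j ∈ Finset.range m, per P.shifts (i + j) := by
    intro i m
    induction m with
    | zero => simp
    | succ m ih => rw [← add_assoc, ver_succ, ih, Finset.sum_range_succ, add_assoc]
  have hV : ∀ i < P.shifts.length, ∀ k ≤ P.shifts.length,
      crs (per P.shifts i) (ver P i) ≤ crs (per P.shifts i) (ver P k) := by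
    intro i hi k hk
    have aux : ∀ m ≤ P.shifts.length,
        crs (per P.shifts i) (ver P i) ≤ crs (per P.shifts i) (ver P (i + m)) := by
      intro m hm
      rw [hver, crs_add]; linarith [hcore i m hm]
    rcases le_total i k with hik | hik
    · have := aux (k - i) (by omega)
      rwa [Nat.add_sub_cancel' hik] at this
    · have := aux (k + P.shifts.length - i) (by omega)
      rwa [Nat.add_sub_cancel' (by omega), ver_add P hcl] at this
  have htr : ∀ i < P.shifts.length, ∀ x ∈ frontier K,
      crs (per P.shifts i) (ver P i) ≤ crs (per P.shifts i) x := by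
    intro i hi x hx
    rw [hK.boundary] at hx
    obtain ⟨k, hk, u, hu0, hu1, rfl⟩ := of_mem_trace P hl hcl x hx
    have h1 := hV i hi k hk.le
    have h2 := hV i hi (k + 1) hk
    rw [ver_succ, crs_add] at h2
    rw [crs_add, crs_smul]
    nlinarith
  let U : Set (ℝ × ℝ) := {x | ∀ i < P.shifts.length,
    crs (per P.shifts i) (ver P i) < crs (per P.shifts i) x}
  have hUc : Convex ℝ U := by
    intro x hx y hy a b ha hb hab i hi
    have h1 := hx i hi
    have h2 := hy i hi
    rw [crs_add, crs_smul, crs_smul]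
    have : a = 1 - b := by linarith
    subst this
    rcases hb.lt_or_eq with hb' | hb'
    · nlinarith
    · rw [← hb']; linarith
  have hsub : interior K ⊆ U := fun x hx i hi =>
    interior_pos K hK.compact _ (hne i) _ (htr i hi) x hx
  have hdisj : U ∩ frontier K = ∅ := by
    ext x
    simp only [mem_inter_iff, mem_empty_iff_false, iff_false, not_and]
    intro hxU hx
    rw [hK.boundary] at hx
    obtain ⟨k, hk, u, hu0, hu1, rfl⟩ := of_mem_trace P hl hcl x hx
    have := hxU k hk
    rw [crs_add, crs_smul, crs_self] at this
    linarith
  have hint : (interior K).Nonempty := by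
    have hf : (frontier K).Nonempty := by
      rw [hK.boundary]; exact ⟨_, mem_trace P 0 hp 0 le_rfl zero_lt_one⟩
    obtain ⟨x, hx⟩ := hf
    have : x ∈ K := hK.compact.isClosed.frontier_subset hx
    rw [hK.regular] at this
    exact closure_nonempty_iff.1 ⟨x, this⟩
  have hUsub : U ⊆ interior K := by
    have hUK : U ⊆ interior K ∪ Kᶜ := by
      intro x hx
      by_cases hxK : x ∈ K
      · left
        by_contra hxi
        have : x ∈ U ∩ frontier K := ⟨hx, by
          rw [hK.compact.isClosed.frontier_eq]; exact ⟨hxK, hxi⟩⟩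
        rw [hdisj] at this; exact this
      · right; exact hxK
    refine hUc.isPreconnected.subset_left_of_subset_union isOpen_interior
      hK.compact.isClosed.isOpen_compl ?_ hUK ?_
    · exact disjoint_compl_right.mono_left interior_subset
    · obtain ⟨x, hx⟩ := hint
      exact ⟨x, hsub hx, hx⟩
  rw [hK.regular, ← subset_antisymm hUsub hsub]
  exact hUc.closure

lemma interior_ne (K : Set (ℝ × ℝ)) (P : Polyline) (hK : IsSimplePolygon K P) :
    (interior K).Nonempty := by
  have hp : 0 < P.shifts.length := List.length_pos_iff.2 hK.proper.1
  have hx : ver P 0 + (0 : ℝ) • per P.shifts 0 ∈ frontier K := by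
    rw [hK.boundary]; exact mem_trace P 0 hp 0 le_rfl zero_lt_one
  have := hK.compact.isClosed.frontier_subset hx
  rw [hK.regular] at this
  exact closure_nonempty_iff.1 ⟨_, this⟩

lemma support (K : Set (ℝ × ℝ)) (hc : Convex ℝ K) (hi : (interior K).Nonempty)
    (a s : ℝ × ℝ) (hs : s ≠ 0) (ha : a ∈ frontier K)
    (h1 : a + (1 / 4 : ℝ) • s ∈ K) (h2 : a - (1 / 4 : ℝ) • s ∈ K) :
    (∀ x ∈ K, 0 ≤ crs s (x - a)) ∨ (∀ x ∈ K, crs s (x - a) ≤ 0) := by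
  obtain ⟨f, hf, hmax⟩ := geometric_hahn_banach_of_nonempty_interior_point hc ha.2 hi
  have e1 := hmax _ h1
  have e2 := hmax _ h2
  rw [map_add, map_smul, smul_eq_mul] at e1
  rw [map_sub, map_smul, smul_eq_mul] at e2
  have hfs : f s = 0 := by linarith
  have hdec : ∀ z : ℝ × ℝ, f z = z.1 * f (1, 0) + z.2 * f (0, 1) := by
    intro z
    have : z = z.1 • ((1, 0) : ℝ × ℝ) + z.2 • ((0, 1) : ℝ × ℝ) := by ext <;> simp
    conv_lhs => rw [this]
    rw [map_add, map_smul, map_smul, smul_eq_mul, smul_eq_mul]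
  set α := f (1, 0)
  set β := f (0, 1)
  rw [hdec] at hfs
  have hpos : 0 < s.1 ^ 2 + s.2 ^ 2 := by
    by_contra hc
    apply hs
    exact Prod.ext (by simp; nlinarith [sq_nonneg s.1, sq_nonneg s.2])
      (by simp; nlinarith [sq_nonneg s.1, sq_nonneg s.2])
  have key : ∀ z, (s.1 ^ 2 + s.2 ^ 2) * f z = crs s z * (s.1 * β - s.2 * α) := by
    intro z
    rw [hdec, crs]
    linear_combination (s.1 * z.1 + s.2 * z.2) * hfs
  have hle : ∀ x ∈ K, crs s (x - a) * (s.1 * β - s.2 * α) ≤ 0 := by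
    intro x hx
    rw [← key, map_sub]
    have := hmax x hx
    nlinarith
  rcases lt_trichotomy (s.1 * β - s.2 * α) 0 with hd | hd | hd
  · left
    intro x hx
    by_contra hcon
    have := hle x hx
    nlinarith [mul_pos_of_neg_of_neg (not_le.1 hcon) hd]
  · exfalso
    apply hf
    ext
    all_goals
      rw [hd] at key
      simp only [mul_zero, mul_eq_zero, hpos.ne', false_or] at key
      simp [key]
  · right
    intro x hx
    by_contra hcon
    have := hle x hx
    nlinarith [mul_pos (not_le.1 hcon) hd]

lemma ver_mod (P : Polyline) (h : P.Closed) (k : ℕ) :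
    ver P (k % P.shifts.length) = ver P k := by
  have aux : ∀ q r, ver P (r + P.shifts.length * q) = ver P r := by
    intro q r
    induction q with
    | zero => simp
    | succ q ih => rw [Nat.mul_succ, ← add_assoc, ver_add P h, ih]
  conv_rhs => rw [← Nat.mod_add_div k P.shifts.length, aux]

lemma per_mod (l : List (ℝ × ℝ)) (k : ℕ) : per l (k % l.length) = per l k := by simp [per]

lemma not_opp (l : List (ℝ × ℝ)) (hl : l ≠ []) (h : NonReverse (l ++ l.take 1)) (k : ℕ) :
    ¬ Opp (per l k) (per l (k + 1)) := by
  have hp : 0 < l.length := List.length_pos_iff.2 hl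
  have hk := Nat.mod_lt k hp
  have h' : List.IsChain (fun v w => ¬ Opp v w) (l ++ l.take 1) := h
  rw [List.isChain_iff_getElem] at h'
  have hlen : (l ++ l.take 1).length = l.length + 1 := by simp; omega
  have := h' (k % l.length) (by omega)
  rw [← List.getD_eq_getElem _ 0, ← List.getD_eq_getElem _ 0, getD_take1 l hl _ (by omega),
    getD_take1 l hl _ (by omega), per_mod] at this
  have e2 : per l (k % l.length + 1) = per l (k + 1) := by simp [per]
  rwa [e2] at this

lemma angles_of_convex (K : Set (ℝ × ℝ)) (P : Polyline) (hK : IsSimplePolygon K P)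
    (hc : Convex ℝ K) : ∀ k, 0 ≤ vangle (per P.shifts k) (per P.shifts (k + 1)) := by
  have hne := per_ne _ hK.proper.1 hK.proper.2
  have hl := hK.proper.1
  have hcl := hK.simpleClosed.1
  have hp : 0 < P.shifts.length := List.length_pos_iff.2 hl
  have hopp := not_opp _ hl hK.nonReverse
  have hint := interior_ne K P hK
  have hfr : ∀ i (u : ℝ), 0 ≤ u → u < 1 → ver P i + u • per P.shifts i ∈ frontier K := by
    intro i u h0 h1
    rw [hK.boundary, ← ver_mod P hcl, ← per_mod]
    exact mem_trace P _ (Nat.mod_lt _ hp) u h0 h1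
  have hmemK : ∀ i (u : ℝ), 0 ≤ u → u < 1 → ver P i + u • per P.shifts i ∈ K :=
    fun i u h0 h1 => hK.compact.isClosed.frontier_subset (hfr i u h0 h1)
  have hverK : ∀ i, ver P i ∈ K := by
    intro i
    have := hmemK i 0 le_rfl zero_lt_one
    rwa [zero_smul, add_zero] at this
  let S : ℝ → ℕ → Prop := fun ε i => ∀ x ∈ K, 0 ≤ ε * crs (per P.shifts i) (x - ver P i)
  have hS : ∀ i, S 1 i ∨ S (-1) i := by
    intro i
    have hmid := hfr i (1 / 2) (by norm_num) (by norm_num)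
    have h1 := hmemK i (3 / 4) (by norm_num) (by norm_num)
    have h2 := hmemK i (1 / 4) (by norm_num) (by norm_num)
    have hcr : ∀ x, crs (per P.shifts i) (x - (ver P i + (1 / 2 : ℝ) • per P.shifts i)) =
        crs (per P.shifts i) (x - ver P i) := by
      intro x
      rw [crs_sub, crs_add, crs_smul, crs_self, crs_sub]; ring
    have := support K hc hint _ (per P.shifts i) (hne i) hmid
      (by convert h1 using 1; module) (by convert h2 using 1; module)
    rcases this with h | h
    · left; intro x hx
      have := h x hx
      rw [hcr] at this; linarith
    · right; intro x hx
      have := h x hx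
      rw [hcr] at this; linarith
  have hnot : ∀ ε i, (ε = 1 ∨ ε = -1) → S ε i → S (-ε) i → False := by
    intro ε i hε h1 h2
    obtain ⟨x, hx⟩ := hint
    obtain ⟨y, hy, hlt⟩ := exists_lower K (per P.shifts i) x (hne i) hx
    have a1 := h1 x (interior_subset hx)
    have a2 := h2 x (interior_subset hx)
    have b1 := h1 y hy
    have b2 := h2 y hy
    rw [crs_sub] at a1 a2 b1 b2
    rcases hε with rfl | rfl <;> linarith
  have hcrs : ∀ ε i, S ε i → 0 ≤ ε * crs (per P.shifts i) (per P.shifts (i + 1)) := by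
    intro ε i h
    have := h _ (hverK (i + 2))
    have e : ver P (i + 2) - ver P i = per P.shifts i + per P.shifts (i + 1) := by
      rw [show i + 2 = (i + 1) + 1 from rfl, ver_succ, ver_succ]; abel
    rwa [e, crs_add, crs_self, zero_add] at this
  have hstep : ∀ ε i, (ε = 1 ∨ ε = -1) → S ε i → S ε (i + 1) := by
    intro ε i hε h
    have hor : S ε (i + 1) ∨ S (-ε) (i + 1) := by
      rcases hε with rfl | rfl
      · exact hS _
      · rw [neg_neg]; exact (hS _).symm
    rcases hor with h' | h'
    · exact h'
    exfalso
    have c1 := hcrs ε i h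
    have c2 := h' _ (hverK i)
    have e : ver P i - ver P (i + 1) = (-1 : ℝ) • per P.shifts i := by
      rw [ver_succ]; module
    rw [e, crs_smul] at c2
    have anti : crs (per P.shifts (i + 1)) (per P.shifts i) =
      - crs (per P.shifts i) (per P.shifts (i + 1)) := by simp only [crs]; ring
    rw [anti] at c2
    have hz : crs (per P.shifts i) (per P.shifts (i + 1)) = 0 := by
      rcases hε with rfl | rfl <;> linarith
    obtain ⟨a, ha⟩ := par_of_crs (hne i) hz
    have hapos : 0 < a := by
      rcases lt_trichotomy a 0 with h0 | h0 | h0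
      · exact absurd ⟨a, h0, ha⟩ (hopp i)
      · rw [h0, zero_smul] at ha; exact absurd ha (hne _)
      · exact h0
    apply hnot ε i hε h
    intro x hx
    have := h' x hx
    have e2 : crs (per P.shifts (i + 1)) (x - ver P (i + 1)) =
        a * crs (per P.shifts i) (x - ver P i) := by
      rw [ver_succ, ha]; simp only [crs, Prod.smul_fst, Prod.smul_snd, Prod.fst_sub, Prod.snd_sub,
        Prod.fst_add, Prod.snd_add, smul_eq_mul]; ring
    rw [e2] at this
    have h3 : 0 ≤ a * (-ε * crs (per P.shifts i) (x - ver P i)) := by linarith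
    exact nonneg_of_mul_nonneg_right h3 hapos
  have hall : ∀ ε, (ε = 1 ∨ ε = -1) → S ε 0 → ∀ i, S ε i := by
    intro ε hε h i
    induction i with
    | zero => exact h
    | succ i ih => exact hstep ε i hε ih
  rcases hS 0 with h | h
  · intro k
    rw [vangle_nonneg_iff (hne k)]
    have := hcrs 1 k (hall 1 (Or.inl rfl) h k)
    linarith
  · exfalso
    have ho := hK.orient
    rw [rotClosed_eq_s10 _ hl] at ho
    have : ∑ i ∈ Finset.range P.shifts.length,
        vangle (per P.shifts i) (per P.shifts (i + 1)) ≤ 0 := by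
      apply Finset.sum_nonpos
      intro k _
      apply vangle_nonpos (hne _) (hne _) (hopp _)
      have := hcrs (-1) k (hall (-1) (Or.inr rfl) h k)
      linarith
    linarith [Real.pi_pos]

/-- For every simple polygon `K` one has `aco K ≤ 0`, with equality if and
only if `K` is convex. -/
theorem aco_nonpos_and_eq_zero_iff_convex (K : Set (ℝ × ℝ)) (P : Polyline)
    (hK : IsSimplePolygon K P) :
    acoClosed P.shifts ≤ 0 ∧ (acoClosed P.shifts = 0 ↔ Convex ℝ K) := by
  have hlen : 2 ≤ P.shifts.length := by
    have hp : 0 < P.shifts.length := List.length_pos_iff.2 hK.proper.1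
    by_contra hcon
    have h1 : P.shifts.length = 1 := by omega
    have hs := sum_per P hK.simpleClosed.1
    rw [h1, Finset.sum_range_one] at hs
    exact per_ne _ hK.proper.1 hK.proper.2 0 hs
  refine ⟨aco_nonpos _, ?_⟩
  rw [aco_eq_zero_iff _ hlen]
  exact ⟨convex_of_angles K P hK, angles_of_convex K P hK⟩
end
end
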